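/- arXiv:1808.03126 — 2 statements merged into one kernel-verified Lean document; each statement's English description precedes it below -/
import Mathlib

section
/- For any permutation of diagonal labels achievable in the convex pentagon, the parity of the number of flips in a flip sequence that realizes a transposition of the two diagonal labels while returning to the starting triangulation is odd; in particular at least 5 flips are needed and 5 suffice. -/
open scoped Classical

/-- `(a, b)` is a diagonal of the convex `n`-gon with vertices `0, …, n-1`
(pairs of non-adjacent vertices, written with `a < b`). -/
def IsDiag (n a b : ℕ) : Prop :=
  a < b ∧ b < n ∧ a + 2 ≤ b ∧ ¬(a = 0 ∧ b = n - 1)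

/-- Two diagonals (as sorted pairs) of a convex polygon cross, i.e. their
endpoint pairs interleave in the cyclic order. -/
def Cross (p q : ℕ × ℕ) : Prop :=
  (p.1 < q.1 ∧ q.1 < p.2 ∧ p.2 < q.2) ∨ (q.1 < p.1 ∧ p.1 < q.2 ∧ q.2 < p.2)

/-- `T` is a triangulation of the convex `n`-gon: a maximal set of pairwise
non-crossing diagonals. -/
def IsTriangulation (n : ℕ) (T : Finset (ℕ × ℕ)) : Prop :=
  (∀ p ∈ T, IsDiag n p.1 p.2) ∧
  (∀ p ∈ T, ∀ q ∈ T, p ≠ q → ¬ Cross p q) ∧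
  (∀ p : ℕ × ℕ, IsDiag n p.1 p.2 → p ∉ T → ∃ q ∈ T, Cross p q)

/-- `T'` is obtained from `T` by a single flip: one diagonal is removed and
another is inserted, the result being again a triangulation. -/
def Flip (n : ℕ) (T T' : Finset (ℕ × ℕ)) : Prop :=
  IsTriangulation n T ∧ IsTriangulation n T' ∧
  ∃ d d', d ∈ T ∧ d' ∉ T ∧ T' = insert d' (T.erase d)

/-- There is a sequence of exactly `k` flips transforming `T` into `T'`. -/
def FlipSeq (n k : ℕ) (T T' : Finset (ℕ × ℕ)) : Prop :=
  ∃ s : ℕ → Finset (ℕ × ℕ), s 0 = T ∧ s k = T' ∧ ∀ i < k, Flip n (s i) (s (i + 1))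



/-- An edge-labeled triangulation of the convex pentagon: an (unlabeled)
triangulation together with the positions of the two diagonal labels
(labels indexed by `Bool`). -/
structure LT5 where
  /-- the underlying unlabeled triangulation -/
  T : Finset (ℕ × ℕ)
  /-- the diagonal carrying each of the two labels -/
  pos : Bool → ℕ × ℕ
  tri : IsTriangulation 5 T
  mem : ∀ b, pos b ∈ T
  inj : pos true ≠ pos false

/-- A labeled flip: remove a diagonal, insert the other diagonal of the empty
quadrilateral, and transfer the removed diagonal's label to the inserted one. -/
def LFlip (X Y : LT5) : Prop :=
  ∃ d d' : ℕ × ℕ, d ∈ X.T ∧ d' ∉ X.T ∧ Y.T = insert d' (X.T.erase d) ∧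
    ∀ b, Y.pos b = if X.pos b = d then d' else X.pos b

/-- A sequence of exactly `k` labeled flips from `X` to `Y`. -/
def LFlipSeq (k : ℕ) (X Y : LT5) : Prop :=
  ∃ s : ℕ → LT5, s 0 = X ∧ s k = Y ∧ ∀ i < k, LFlip (s i) (s (i + 1))

/-- The five diagonals of the convex pentagon, indexed by the sum of their endpoints modulo 5.
Distinct diagonals are non-crossing exactly when their indices are cyclically adjacent. -/
def pentDiag : ZMod 5 → ℕ × ℕ :=
  ![(1, 4), (2, 4), (0, 2), (0, 3), (1, 3)]

theorem pentDiag_injective : Function.Injective pentDiag := by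
  unfold Function.Injective
  decide

theorem isDiag_pentDiag : ∀ i, IsDiag 5 (pentDiag i).1 (pentDiag i).2 := by
  unfold IsDiag
  decide

theorem exists_pentDiag_eq {p : ℕ × ℕ} (hp : IsDiag 5 p.1 p.2) : ∃ i, pentDiag i = p := by
  obtain ⟨a, b⟩ := p
  obtain ⟨hab, hb, h2, h3⟩ := hp
  dsimp only at *
  have ha : a < 5 := by omega
  revert hab h2 h3
  interval_cases a <;> interval_cases b <;> decide

theorem cross_pentDiag_iff : ∀ i j, Cross (pentDiag i) (pentDiag j) ↔ (i - j) ^ 2 = 4 := by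
  unfold Cross
  decide

theorem LT5.isDiag_pos (X : LT5) (b : Bool) : IsDiag 5 (X.pos b).1 (X.pos b).2 :=
  X.tri.1 _ (X.mem b)

/-- The index of the diagonal carrying a given label. -/
noncomputable def LT5.idx (X : LT5) (b : Bool) : ZMod 5 :=
  (exists_pentDiag_eq (X.isDiag_pos b)).choose

theorem LT5.pentDiag_idx (X : LT5) (b : Bool) : pentDiag (X.idx b) = X.pos b :=
  (exists_pentDiag_eq (X.isDiag_pos b)).choose_spec

theorem IsTriangulation.sq_sub_eq_one {T : Finset (ℕ × ℕ)} (hT : IsTriangulation 5 T)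
    {i j : ZMod 5} (hi : pentDiag i ∈ T) (hj : pentDiag j ∈ T) (hij : i ≠ j) :
    (i - j) ^ 2 = 1 := by
  have h := hT.2.1 _ hi _ hj (pentDiag_injective.ne hij)
  rw [cross_pentDiag_iff] at h
  have noncross : ∀ i j : ZMod 5, i ≠ j → (i - j) ^ 2 ≠ 4 → (i - j) ^ 2 = 1 := by decide
  exact noncross i j hij h

theorem LT5.sq_idx_sub (X : LT5) (b : Bool) : (X.idx b - X.idx (!b)) ^ 2 = 1 := by
  have hne : X.idx true ≠ X.idx false := fun h =>
    X.inj (by rw [← X.pentDiag_idx, ← X.pentDiag_idx, h])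
  refine X.tri.sq_sub_eq_one (by rw [pentDiag_idx]; exact X.mem _)
    (by rw [pentDiag_idx]; exact X.mem _) ?_
  cases b
  exacts [hne.symm, hne]

theorem LT5.mem_T_iff (X : LT5) (p : ℕ × ℕ) : p ∈ X.T ↔ ∃ b, X.pos b = p := by
  refine ⟨fun hp => ?_, fun ⟨b, hb⟩ => hb ▸ X.mem b⟩
  obtain ⟨i, rfl⟩ := exists_pentDiag_eq (X.tri.1 p hp)
  by_contra! h
  have key (b : Bool) : (X.idx b - i) ^ 2 = 1 :=
    X.tri.sq_sub_eq_one (by rw [pentDiag_idx]; exact X.mem b) hp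
      fun hi => h b (by rw [← X.pentDiag_idx, hi])
  have no_triangle : ∀ i j k : ZMod 5, (i - j) ^ 2 = 1 → (i - k) ^ 2 = 1 → (j - k) ^ 2 ≠ 1 := by
    decide
  exact no_triangle _ _ _ (X.sq_idx_sub true) (key true) (key false)

theorem LT5.eq_of_idx_eq {X Y : LT5} (h : X.idx = Y.idx) : X = Y := by
  have hpos : X.pos = Y.pos := by
    funext b
    rw [← X.pentDiag_idx, ← Y.pentDiag_idx, h]
  have hT : X.T = Y.T := by
    ext p
    rw [X.mem_T_iff, Y.mem_T_iff, hpos]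
  cases X
  cases Y
  subst hpos hT
  rfl

theorem isTriangulation_pair {i j : ZMod 5} (hij : (i - j) ^ 2 = 1) :
    IsTriangulation 5 {pentDiag i, pentDiag j} := by
  have hcross : ∀ i j : ZMod 5, (i - j) ^ 2 = 1 → (i - j) ^ 2 ≠ 4 ∧ (j - i) ^ 2 ≠ 4 := by
    decide
  have hmax : ∀ i j k : ZMod 5, (i - j) ^ 2 = 1 → k ≠ i → k ≠ j →
      (k - i) ^ 2 = 4 ∨ (k - j) ^ 2 = 4 := by
    decide
  refine ⟨?_, ?_, ?_⟩
  · simp [isDiag_pentDiag]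
  · simp [cross_pentDiag_iff, hcross i j hij]
  · intro p hp hpT
    obtain ⟨k, rfl⟩ := exists_pentDiag_eq hp
    simp only [Finset.mem_insert, Finset.mem_singleton, pentDiag_injective.eq_iff, not_or] at hpT
    simpa [cross_pentDiag_iff] using hmax i j k hij hpT.1 hpT.2

theorem LT5.exists_idx_eq (c : Bool → ZMod 5) (hc : (c true - c false) ^ 2 = 1) :
    ∃ X : LT5, X.idx = c := by
  refine ⟨⟨{pentDiag (c true), pentDiag (c false)}, fun b => pentDiag (c b),
    isTriangulation_pair hc, by simp, fun h => ?_⟩, ?_⟩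
  · rw [pentDiag_injective h, sub_self] at hc
    exact absurd hc (by decide)
  · funext b
    exact pentDiag_injective (LT5.pentDiag_idx _ b)

/-- In terms of indices, a labeled flip reflects one index across the other. -/
theorem lflip_iff (X Y : LT5) :
    LFlip X Y ↔ ∃ b, Y.idx b = 2 * X.idx (!b) - X.idx b ∧ Y.idx (!b) = X.idx (!b) := by
  have hne (b : Bool) : X.pos (!b) ≠ X.pos b := by
    cases b
    exacts [X.inj, X.inj.symm]
  constructor
  · rintro ⟨d, d', hd, hd', -, hpos⟩
    obtain ⟨b, rfl⟩ := (X.mem_T_iff d).1 hd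
    have h₁ : Y.idx (!b) = X.idx (!b) := pentDiag_injective <| by
      rw [Y.pentDiag_idx, X.pentDiag_idx, hpos, if_neg (hne b)]
    have h₂ : Y.idx b ≠ X.idx b := fun h => hd' <| by
      have h' : Y.pos b = X.pos b := by rw [← Y.pentDiag_idx, ← X.pentDiag_idx, h]
      rw [hpos, if_pos rfl] at h'
      exact h' ▸ hd
    have hY := Y.sq_idx_sub b
    rw [h₁] at hY
    have reflect : ∀ i j k : ZMod 5, (i - j) ^ 2 = 1 → (k - j) ^ 2 = 1 → k ≠ i →
        k = 2 * j - i := by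
      decide
    exact ⟨b, reflect _ _ _ (X.sq_idx_sub b) hY h₂, h₁⟩
  · rintro ⟨b, h₁, h₂⟩
    have hkeep : Y.pos (!b) = X.pos (!b) := by rw [← Y.pentDiag_idx, ← X.pentDiag_idx, h₂]
    have hnew : Y.pos b ∉ X.T := by
      rw [X.mem_T_iff]
      rintro ⟨b', hb'⟩
      rw [← Y.pentDiag_idx, ← X.pentDiag_idx, pentDiag_injective.eq_iff, h₁] at hb'
      have avoid : ∀ i j : ZMod 5, (i - j) ^ 2 = 1 → i ≠ 2 * j - i ∧ j ≠ 2 * j - i := by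
        decide
      obtain rfl | rfl := Bool.eq_or_eq_not b' b
      · exact (avoid _ _ (X.sq_idx_sub _)).1 hb'
      · exact (avoid _ _ (X.sq_idx_sub b)).2 hb'
    have hpos (b' : Bool) : Y.pos b' = if X.pos b' = X.pos b then Y.pos b else X.pos b' := by
      obtain rfl | rfl := Bool.eq_or_eq_not b' b
      · rw [if_pos rfl]
      · rw [if_neg (hne b), hkeep]
    refine ⟨X.pos b, Y.pos b, X.mem b, hnew, ?_, hpos⟩
    have hbool (P : Bool → Prop) : (∃ b', P b') ↔ P b ∨ P (!b) := by
      cases b <;> simp [or_comm]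
    ext p
    rw [Finset.mem_insert, Finset.mem_erase, Y.mem_T_iff, X.mem_T_iff, hbool, hbool, hkeep]
    have := hne b
    grind

/-- Every flip reverses the sign of the index difference and moves the index sum by `2` or
`-2`. -/
theorem LFlip.idx_sub_and_add {X Y : LT5} (h : LFlip X Y) :
    Y.idx true - Y.idx false = -(X.idx true - X.idx false) ∧
      (Y.idx true + Y.idx false - (X.idx true + X.idx false)) ^ 2 = 4 := by
  obtain ⟨b, h₁, h₂⟩ := (lflip_iff X Y).1 h
  have hX := X.sq_idx_sub b
  cases b <;> simp only [Bool.not_true, Bool.not_false] at h₁ h₂ hX <;> rw [h₁, h₂] <;>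
    exact ⟨by ring, by linear_combination 4 * hX⟩

theorem idx_sub_eq_neg_one_pow_mul {s : ℕ → LT5} {k : ℕ}
    (hs : ∀ i < k, LFlip (s i) (s (i + 1))) :
    (s k).idx true - (s k).idx false = (-1) ^ k * ((s 0).idx true - (s 0).idx false) := by
  induction k with
  | zero => simp
  | succ k ih =>
    rw [(hs k k.lt_succ_self).idx_sub_and_add.1, ih fun i hi => hs i (hi.trans k.lt_succ_self)]
    ring

theorem LFlipSeq.odd_and_five_le {X Y : LT5} {k : ℕ} (h : LFlipSeq k X Y)
    (hswap : ∀ b, Y.pos b = X.pos (!b)) : Odd k ∧ 5 ≤ k := by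
  have hidx (b : Bool) : Y.idx b = X.idx (!b) :=
    pentDiag_injective (by rw [Y.pentDiag_idx, X.pentDiag_idx, hswap])
  have ht : Y.idx true = X.idx false := hidx true
  have hf : Y.idx false = X.idx true := hidx false
  obtain ⟨s, rfl, rfl, hs⟩ := h
  have hodd : Odd k := by
    by_contra hk
    have hsub := idx_sub_eq_neg_one_pow_mul hs
    rw [(Nat.not_odd_iff_even.1 hk).neg_one_pow, one_mul, ht, hf] at hsub
    have hX := (s 0).sq_idx_sub true
    have no_fix : ∀ i j : ZMod 5, j - i = i - j → (i - j) ^ 2 ≠ 1 := by decide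
    exact no_fix _ _ hsub hX
  refine ⟨hodd, ?_⟩
  by_contra! hk
  obtain rfl | rfl : k = 1 ∨ k = 3 := by
    obtain ⟨m, rfl⟩ := hodd
    omega
  · have h₀ := (hs 0 (by omega)).idx_sub_and_add.2
    rw [ht, hf, add_comm, sub_self] at h₀
    revert h₀
    decide
  · have h₀ := (hs 0 (by omega)).idx_sub_and_add.2
    have h₁ := (hs 1 (by omega)).idx_sub_and_add.2
    have h₂ := (hs 2 (by omega)).idx_sub_and_add.2
    rw [ht, hf, add_comm ((s 0).idx false)] at h₂
    have no_closed : ∀ x y z : ZMod 5, (y - x) ^ 2 = 4 → (z - y) ^ 2 = 4 → (x - z) ^ 2 ≠ 4 := by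
      decide
    exact no_closed _ _ _ h₀ h₁ h₂

theorem LT5.exists_lflipSeq_five_swap (X : LT5) :
    ∃ Y : LT5, LFlipSeq 5 X Y ∧ ∀ b, Y.idx b = X.idx (!b) := by
  have hstep (Z : LT5) (b : Bool) : ∃ Z' : LT5, LFlip Z Z' ∧
      Z'.idx b = 2 * Z.idx (!b) - Z.idx b ∧ Z'.idx (!b) = Z.idx (!b) := by
    obtain ⟨Z', hZ'⟩ := exists_idx_eq
      (Function.update Z.idx b (2 * Z.idx (!b) - Z.idx b)) (by
        have hZ := Z.sq_idx_sub b
        cases b <;> simp at hZ ⊢ <;> linear_combination hZ)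
    have h₁ : Z'.idx b = 2 * Z.idx (!b) - Z.idx b := by simp [hZ']
    have h₂ : Z'.idx (!b) = Z.idx (!b) := by simp [hZ']
    exact ⟨Z', (lflip_iff Z Z').2 ⟨b, h₁, h₂⟩, h₁, h₂⟩
  obtain ⟨X₁, f₁, t₁, u₁⟩ := hstep X true
  obtain ⟨X₂, f₂, t₂, u₂⟩ := hstep X₁ false
  obtain ⟨X₃, f₃, t₃, u₃⟩ := hstep X₂ true
  obtain ⟨X₄, f₄, t₄, u₄⟩ := hstep X₃ false
  obtain ⟨X₅, f₅, t₅, u₅⟩ := hstep X₄ true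
  refine ⟨X₅, ⟨fun n => [X, X₁, X₂, X₃, X₄].getD n X₅, rfl, rfl, fun i hi => ?_⟩, ?_⟩
  · interval_cases i
    exacts [f₁, f₂, f₃, f₄, f₅]
  · have five : (5 : ZMod 5) = 0 := by decide
    simp only [Bool.not_true, Bool.not_false] at *
    rintro (_ | _)
    · simp only [*, Bool.not_false]
      linear_combination (X.idx false - X.idx true) * five
    · simp only [*, Bool.not_true]
      linear_combination (X.idx false - X.idx true) * five

/-- Any flip sequence in the convex pentagon that returns to the starting unlabeled
triangulation with the two diagonal labels transposed has odd length; in particular at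
least 5 flips are needed, and 5 flips suffice. -/
theorem pentagon_label_swap_parity (X : LT5) :
    (∀ (k : ℕ) (Y : LT5), LFlipSeq k X Y → Y.T = X.T →
      (∀ b, Y.pos b = X.pos (!b)) → Odd k ∧ 5 ≤ k) ∧
    (∃ Y : LT5, LFlipSeq 5 X Y ∧ Y.T = X.T ∧ ∀ b, Y.pos b = X.pos (!b)) := by
  refine ⟨fun k Y h _ hswap => h.odd_and_five_le hswap, ?_⟩
  obtain ⟨Y, hY, hidx⟩ := X.exists_lflipSeq_five_swap
  have hpos (b : Bool) : Y.pos b = X.pos (!b) := by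
    rw [← Y.pentDiag_idx, ← X.pentDiag_idx, hidx]
  refine ⟨Y, hY, ?_, hpos⟩
  ext p
  simp [Y.mem_T_iff, X.mem_T_iff, hpos, or_comm]
end

section
/- For any two triangulations of a convex polygon on n vertices, the set of diagonals common to both triangulations is preserved by some shortest flip sequence only if each such flip sequence never needs to flip a common diagonal when the common diagonals separate the polygon; concretely: if a diagonal d belongs to both triangulations T1 and T2, then T1 and T2 restrict to triangulations of the two sub-polygons cut off by d, and a flip sequence between the restrictions concatenates to a flip sequence between T1 and T2 of the same total length. -/
open scoped Classical

/-- The triangulation induced on the sub-polygon with vertices `a, a+1, …, b`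
(reindexed as `0, …, b - a`) by a triangulation containing the diagonal `(a, b)`. -/
noncomputable def restrictAbove (a b : ℕ) (T : Finset (ℕ × ℕ)) : Finset (ℕ × ℕ) :=
  (T.filter (fun p => a ≤ p.1 ∧ p.2 ≤ b ∧ p ≠ (a, b))).image
    (fun p => (p.1 - a, p.2 - a))

/-- Cyclic reindexing sending `b` to `0` in the `n`-gon. -/
def rot (n b i : ℕ) : ℕ := if b ≤ i then i - b else i + (n - b)

/-- The triangulation induced on the sub-polygon with vertices
`b, b+1, …, n-1, 0, …, a` (reindexed as `0, …, n - (b - a)`) by a triangulation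
containing the diagonal `(a, b)`. -/
noncomputable def restrictBelow (n a b : ℕ) (T : Finset (ℕ × ℕ)) : Finset (ℕ × ℕ) :=
  (T.filter (fun p => (p.2 ≤ a ∨ b ≤ p.1 ∨ (p.1 ≤ a ∧ b ≤ p.2)) ∧ p ≠ (a, b))).image
    (fun p => (min (rot n b p.1) (rot n b p.2), max (rot n b p.1) (rot n b p.2)))

lemma Cross.symm {p q : ℕ × ℕ} (h : Cross p q) : Cross q p := Or.symm h

/-- `up` and `down` identify the diagonals of an `m`-gon with the diagonals of the `n`-gon
satisfying `P`, and `up` preserves and reflects crossings. -/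
structure SubpolygonChart (n m : ℕ) (P : ℕ × ℕ → Prop) (up down : ℕ × ℕ → ℕ × ℕ) : Prop where
  isDiag_up : ∀ p, IsDiag m p.1 p.2 → IsDiag n (up p).1 (up p).2
  mem_up : ∀ p, IsDiag m p.1 p.2 → P (up p)
  isDiag_down : ∀ p, IsDiag n p.1 p.2 → P p → IsDiag m (down p).1 (down p).2
  up_down : ∀ p, IsDiag n p.1 p.2 → P p → up (down p) = p
  down_up : ∀ p, IsDiag m p.1 p.2 → down (up p) = p
  cross_up : ∀ p q, IsDiag m p.1 p.2 → IsDiag m q.1 q.2 → (Cross (up p) (up q) ↔ Cross p q)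

/-- The diagonals of the `n`-gon other than `d` that do not cross `d` lie on one of the two
sides `P` and `Q` of `d`, and diagonals on different sides do not cross. -/
structure SeparatedBy (n : ℕ) (d : ℕ × ℕ) (P Q : ℕ × ℕ → Prop) : Prop where
  isDiag : IsDiag n d.1 d.2
  cover : ∀ p, IsDiag n p.1 p.2 → ¬ Cross p d → p = d ∨ P p ∨ Q p
  not_left : ¬ P d
  not_right : ¬ Q d
  not_cross_left : ∀ p, IsDiag n p.1 p.2 → P p → ¬ Cross p d
  not_cross_right : ∀ p, IsDiag n p.1 p.2 → Q p → ¬ Cross p d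
  disjoint : ∀ p, IsDiag n p.1 p.2 → P p → ¬ Q p
  not_cross : ∀ p q, IsDiag n p.1 p.2 → IsDiag n q.1 q.2 → P p → Q q → ¬ Cross p q

lemma SeparatedBy.symm {n : ℕ} {d : ℕ × ℕ} {P Q : ℕ × ℕ → Prop} (h : SeparatedBy n d P Q) :
    SeparatedBy n d Q P where
  isDiag := h.isDiag
  cover p hp hc := (h.cover p hp hc).imp_right Or.symm
  not_left := h.not_right
  not_right := h.not_left
  not_cross_left := h.not_cross_right
  not_cross_right := h.not_cross_left
  disjoint p hp hQ hP := h.disjoint p hp hP hQ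
  not_cross p q hp hq hQ hP hc := h.not_cross q p hq hp hP hQ hc.symm

/-- The diagonals of `T` satisfying `P`, transported along `down`. -/
noncomputable def restrictTo (P : ℕ × ℕ → Prop) (down : ℕ × ℕ → ℕ × ℕ) (T : Finset (ℕ × ℕ)) :
    Finset (ℕ × ℕ) :=
  (T.filter P).image down

lemma mem_restrictTo {P : ℕ × ℕ → Prop} {down : ℕ × ℕ → ℕ × ℕ} {T : Finset (ℕ × ℕ)}
    {q : ℕ × ℕ} : q ∈ restrictTo P down T ↔ ∃ p ∈ T, P p ∧ down p = q := by
  simp [restrictTo, and_assoc]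

/-- The set of diagonals consisting of `d` and of the images of `X` and `Y`. -/
noncomputable def glue (d : ℕ × ℕ) (up₁ up₂ : ℕ × ℕ → ℕ × ℕ) (X Y : Finset (ℕ × ℕ)) :
    Finset (ℕ × ℕ) :=
  insert d (X.image up₁ ∪ Y.image up₂)

lemma mem_glue {d : ℕ × ℕ} {up₁ up₂ : ℕ × ℕ → ℕ × ℕ} {X Y : Finset (ℕ × ℕ)} {p : ℕ × ℕ} :
    p ∈ glue d up₁ up₂ X Y ↔ p = d ∨ (∃ x ∈ X, up₁ x = p) ∨ ∃ y ∈ Y, up₂ y = p := by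
  simp [glue]

lemma glue_comm (d : ℕ × ℕ) (up₁ up₂ : ℕ × ℕ → ℕ × ℕ) (X Y : Finset (ℕ × ℕ)) :
    glue d up₁ up₂ X Y = glue d up₂ up₁ Y X := by
  simp only [glue, Finset.union_comm]

lemma FlipSeq.trans {n k l : ℕ} {T U V : Finset (ℕ × ℕ)} (h : FlipSeq n k T U)
    (h' : FlipSeq n l U V) : FlipSeq n (k + l) T V := by
  obtain ⟨s, rfl, rfl, hs⟩ := h
  obtain ⟨t, ht, rfl, hts⟩ := h'
  refine ⟨fun i => if i ≤ k then s i else t (i - k), by simp, ?_, fun i hi => ?_⟩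
  · rcases Nat.eq_zero_or_pos l with rfl | hl
    · simp [ht]
    · simp [hl.ne']
  · rcases lt_trichotomy i k with h | rfl | h
    · simpa [h.le, Nat.succ_le_of_lt h] using hs i h
    · simpa [ht] using hts 0 (by omega)
    · have := hts (i - k) (by omega)
      rw [show i - k + 1 = i + 1 - k by omega] at this
      simpa [show ¬ i ≤ k by omega, show ¬ i + 1 ≤ k by omega] using this

section

variable {n m m' : ℕ} {d : ℕ × ℕ} {P Q : ℕ × ℕ → Prop} {up down up' down' : ℕ × ℕ → ℕ × ℕ}

lemma SubpolygonChart.isTriangulation_restrictTo (hP : SubpolygonChart n m P up down)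
    (hs : SeparatedBy n d P Q) {T : Finset (ℕ × ℕ)} (hT : IsTriangulation n T) (hd : d ∈ T) :
    IsTriangulation m (restrictTo P down T) := by
  obtain ⟨hdiag, hcross, hmax⟩ := hT
  refine ⟨?_, ?_, ?_⟩
  · intro q hq
    obtain ⟨p, hp, hPp, rfl⟩ := mem_restrictTo.1 hq
    exact hP.isDiag_down p (hdiag p hp) hPp
  · intro q hq q' hq' hne hc
    obtain ⟨p, hp, hPp, rfl⟩ := mem_restrictTo.1 hq
    obtain ⟨p', hp', hPp', rfl⟩ := mem_restrictTo.1 hq'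
    rw [← hP.cross_up _ _ (hP.isDiag_down p (hdiag p hp) hPp)
      (hP.isDiag_down p' (hdiag p' hp') hPp'), hP.up_down p (hdiag p hp) hPp,
      hP.up_down p' (hdiag p' hp') hPp'] at hc
    exact hcross p hp p' hp' (fun h => hne (h ▸ rfl)) hc
  · intro p hp hpT
    have hup := hP.isDiag_up p hp
    obtain ⟨q, hq, hc⟩ := hmax (up p) hup fun h =>
      hpT (mem_restrictTo.2 ⟨up p, h, hP.mem_up p hp, hP.down_up p hp⟩)
    have hqd : q ≠ d := by
      rintro rfl
      exact hs.not_cross_left _ hup (hP.mem_up p hp) hc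
    have hqP : P q := by
      rcases hs.cover q (hdiag q hq) (hcross q hq d hd hqd) with h | h | h
      · exact absurd h hqd
      · exact h
      · exact absurd hc (hs.not_cross _ _ hup (hdiag q hq) (hP.mem_up p hp) h)
    refine ⟨down q, mem_restrictTo.2 ⟨q, hq, hqP, rfl⟩, ?_⟩
    rwa [← hP.cross_up _ _ hp (hP.isDiag_down q (hdiag q hq) hqP),
      hP.up_down q (hdiag q hq) hqP]

lemma SubpolygonChart.glue_restrictTo (hP : SubpolygonChart n m P up down)
    (hQ : SubpolygonChart n m' Q up' down') (hs : SeparatedBy n d P Q)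
    {T : Finset (ℕ × ℕ)} (hT : IsTriangulation n T) (hd : d ∈ T) :
    glue d up up' (restrictTo P down T) (restrictTo Q down' T) = T := by
  obtain ⟨hdiag, hcross, -⟩ := hT
  ext p
  rw [mem_glue]
  constructor
  · rintro (rfl | ⟨x, hx, rfl⟩ | ⟨x, hx, rfl⟩)
    · exact hd
    · obtain ⟨p, hp, hPp, rfl⟩ := mem_restrictTo.1 hx
      rwa [hP.up_down p (hdiag p hp) hPp]
    · obtain ⟨p, hp, hPp, rfl⟩ := mem_restrictTo.1 hx
      rwa [hQ.up_down p (hdiag p hp) hPp]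
  · intro hp
    by_cases hpd : p = d
    · exact Or.inl hpd
    rcases hs.cover p (hdiag p hp) (hcross p hp d hd hpd) with h | h | h
    · exact Or.inl h
    · exact Or.inr (Or.inl ⟨down p, mem_restrictTo.2 ⟨p, hp, h, rfl⟩,
        hP.up_down p (hdiag p hp) h⟩)
    · exact Or.inr (Or.inr ⟨down' p, mem_restrictTo.2 ⟨p, hp, h, rfl⟩,
        hQ.up_down p (hdiag p hp) h⟩)

lemma SubpolygonChart.isTriangulation_glue (hP : SubpolygonChart n m P up down)
    (hQ : SubpolygonChart n m' Q up' down') (hs : SeparatedBy n d P Q)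
    {X Y : Finset (ℕ × ℕ)} (hX : IsTriangulation m X) (hY : IsTriangulation m' Y) :
    IsTriangulation n (glue d up up' X Y) := by
  obtain ⟨hXd, hXc, hXm⟩ := hX
  obtain ⟨hYd, hYc, hYm⟩ := hY
  have side : ∀ x ∈ X, IsDiag n (up x).1 (up x).2 ∧ P (up x) := fun x hx =>
    ⟨hP.isDiag_up x (hXd x hx), hP.mem_up x (hXd x hx)⟩
  have side' : ∀ y ∈ Y, IsDiag n (up' y).1 (up' y).2 ∧ Q (up' y) := fun y hy =>
    ⟨hQ.isDiag_up y (hYd y hy), hQ.mem_up y (hYd y hy)⟩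
  refine ⟨?_, ?_, ?_⟩
  · intro p hp
    rcases mem_glue.1 hp with rfl | ⟨x, hx, rfl⟩ | ⟨y, hy, rfl⟩
    · exact hs.isDiag
    · exact (side x hx).1
    · exact (side' y hy).1
  · intro p hp q hq hne hc
    rcases mem_glue.1 hp with rfl | ⟨x, hx, rfl⟩ | ⟨x, hx, rfl⟩ <;>
      rcases mem_glue.1 hq with rfl | ⟨y, hy, rfl⟩ | ⟨y, hy, rfl⟩
    · exact hne rfl
    · exact hs.not_cross_left _ (side y hy).1 (side y hy).2 hc.symm
    · exact hs.not_cross_right _ (side' y hy).1 (side' y hy).2 hc.symm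
    · exact hs.not_cross_left _ (side x hx).1 (side x hx).2 hc
    · exact hXc x hx y hy (fun h => hne (h ▸ rfl))
        ((hP.cross_up x y (hXd x hx) (hXd y hy)).1 hc)
    · exact hs.not_cross _ _ (side x hx).1 (side' y hy).1 (side x hx).2 (side' y hy).2 hc
    · exact hs.not_cross_right _ (side' x hx).1 (side' x hx).2 hc
    · exact hs.not_cross _ _ (side y hy).1 (side' x hx).1 (side y hy).2 (side' x hx).2 hc.symm
    · exact hYc x hx y hy (fun h => hne (h ▸ rfl))
        ((hQ.cross_up x y (hYd x hx) (hYd y hy)).1 hc)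
  · intro p hp hpG
    by_cases hc : Cross p d
    · exact ⟨d, mem_glue.2 (Or.inl rfl), hc⟩
    rcases hs.cover p hp hc with rfl | h | h
    · exact absurd (mem_glue.2 (Or.inl rfl)) hpG
    · have hdown := hP.isDiag_down p hp h
      obtain ⟨q, hq, hqc⟩ := hXm (down p) hdown fun hx =>
        hpG (mem_glue.2 (Or.inr (Or.inl ⟨down p, hx, hP.up_down p hp h⟩)))
      rw [← hP.cross_up _ _ hdown (hXd q hq), hP.up_down p hp h] at hqc
      exact ⟨up q, mem_glue.2 (Or.inr (Or.inl ⟨q, hq, rfl⟩)), hqc⟩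
    · have hdown := hQ.isDiag_down p hp h
      obtain ⟨q, hq, hqc⟩ := hYm (down' p) hdown fun hx =>
        hpG (mem_glue.2 (Or.inr (Or.inr ⟨down' p, hx, hQ.up_down p hp h⟩)))
      rw [← hQ.cross_up _ _ hdown (hYd q hq), hQ.up_down p hp h] at hqc
      exact ⟨up' q, mem_glue.2 (Or.inr (Or.inr ⟨q, hq, rfl⟩)), hqc⟩

lemma SubpolygonChart.up_mem_glue_iff (hP : SubpolygonChart n m P up down)
    (hQ : SubpolygonChart n m' Q up' down') (hs : SeparatedBy n d P Q)
    {X Y : Finset (ℕ × ℕ)} (hX : ∀ x ∈ X, IsDiag m x.1 x.2) (hY : ∀ y ∈ Y, IsDiag m' y.1 y.2)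
    {e : ℕ × ℕ} (he : IsDiag m e.1 e.2) : up e ∈ glue d up up' X Y ↔ e ∈ X := by
  rw [mem_glue]
  constructor
  · rintro (h | ⟨x, hx, h⟩ | ⟨y, hy, h⟩)
    · exact absurd (h ▸ hP.mem_up e he) hs.not_left
    · rwa [← hP.down_up e he, ← h, hP.down_up x (hX x hx)]
    · exact absurd (h ▸ hQ.mem_up y (hY y hy))
        (hs.disjoint _ (hP.isDiag_up e he) (hP.mem_up e he))
  · exact fun h => Or.inr (Or.inl ⟨e, h, rfl⟩)

lemma SubpolygonChart.flip_glue (hP : SubpolygonChart n m P up down)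
    (hQ : SubpolygonChart n m' Q up' down') (hs : SeparatedBy n d P Q)
    {X X' Y : Finset (ℕ × ℕ)} (hX : Flip m X X') (hY : IsTriangulation m' Y) :
    Flip n (glue d up up' X Y) (glue d up up' X' Y) := by
  obtain ⟨hX, hX', e, e', he, he', rfl⟩ := hX
  have hed := hX.1 e he
  have hed' := hX'.1 e' (Finset.mem_insert_self _ _)
  refine ⟨hP.isTriangulation_glue hQ hs hX hY, hP.isTriangulation_glue hQ hs hX' hY,
    up e, up e', (hP.up_mem_glue_iff hQ hs hX.1 hY.1 hed).2 he,
    fun h => he' ((hP.up_mem_glue_iff hQ hs hX.1 hY.1 hed').1 h), ?_⟩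
  have hremoved : up e ∉ glue d up up' (X.erase e) Y := fun h =>
    Finset.notMem_erase e X ((hP.up_mem_glue_iff hQ hs
      (fun x hx => hX.1 x (Finset.mem_of_mem_erase hx)) hY.1 hed).1 h)
  have hglue : glue d up up' (X.erase e) Y = (glue d up up' X Y).erase (up e) := by
    ext p
    by_cases hp : p = up e
    · subst hp
      simpa using hremoved
    · simp only [Finset.mem_erase, mem_glue]
      grind
  rw [← hglue]
  ext p
  simp only [mem_glue, Finset.mem_insert]
  grind

lemma SubpolygonChart.flipSeq_glue (hP : SubpolygonChart n m P up down)
    (hQ : SubpolygonChart n m' Q up' down') (hs : SeparatedBy n d P Q) {k : ℕ}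
    {X X' Y : Finset (ℕ × ℕ)} (hX : FlipSeq m k X X') (hY : IsTriangulation m' Y) :
    FlipSeq n k (glue d up up' X Y) (glue d up up' X' Y) := by
  obtain ⟨s, rfl, rfl, h⟩ := hX
  exact ⟨fun i => glue d up up' (s i) Y, rfl, rfl, fun i hi => hP.flip_glue hQ hs (h i hi) hY⟩

end

/-- The side of `(a, b)` consisting of the vertices `a, …, b`. -/
def SideAbove (a b : ℕ) (p : ℕ × ℕ) : Prop :=
  a ≤ p.1 ∧ p.2 ≤ b ∧ p ≠ (a, b)

/-- The side of `(a, b)` consisting of the vertices `b, …, n - 1, 0, …, a`. -/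
def SideBelow (a b : ℕ) (p : ℕ × ℕ) : Prop :=
  (p.2 ≤ a ∨ b ≤ p.1 ∨ (p.1 ≤ a ∧ b ≤ p.2)) ∧ p ≠ (a, b)

/-- The inverse of `rot` on the vertices of the `n`-gon. -/
def unrot (n b i : ℕ) : ℕ := if i < n - b then i + b else i - (n - b)

/-- The map induced on sorted pairs by a map on vertices. -/
def sortedMap (f : ℕ → ℕ) (p : ℕ × ℕ) : ℕ × ℕ :=
  (min (f p.1) (f p.2), max (f p.1) (f p.2))

lemma restrictAbove_eq (a b : ℕ) (T : Finset (ℕ × ℕ)) :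
    restrictAbove a b T = restrictTo (SideAbove a b) (fun p => (p.1 - a, p.2 - a)) T := by
  ext q
  simp only [mem_restrictTo, restrictAbove, SideAbove, Finset.mem_image, Finset.mem_filter,
    and_assoc]

lemma restrictBelow_eq (n a b : ℕ) (T : Finset (ℕ × ℕ)) :
    restrictBelow n a b T = restrictTo (SideBelow a b) (sortedMap (rot n b)) T := by
  ext q
  simp only [mem_restrictTo, restrictBelow, SideBelow, sortedMap, Finset.mem_image,
    Finset.mem_filter, and_assoc]

lemma separatedBy_sides {n a b : ℕ} (hd : IsDiag n a b) :
    SeparatedBy n (a, b) (SideAbove a b) (SideBelow a b) := by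
  constructor <;>
    simp only [SideAbove, SideBelow, IsDiag, Cross, Prod.forall, Prod.mk.injEq, ne_eq, not_true_eq_false,
      and_false, not_false_eq_true] at hd ⊢ <;>
    intros <;> omega

lemma subpolygonChart_above {n a b : ℕ} (hd : IsDiag n a b) :
    SubpolygonChart n (b - a + 1) (SideAbove a b) (fun p => (p.1 + a, p.2 + a))
      (fun p => (p.1 - a, p.2 - a)) := by
  constructor <;>
    simp only [SideAbove, IsDiag, Cross, Prod.forall, Prod.mk.injEq, ne_eq] at hd ⊢ <;>
    intros <;> omega

lemma subpolygonChart_below {n a b : ℕ} (hd : IsDiag n a b) :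
    SubpolygonChart n (n - (b - a) + 1) (SideBelow a b) (sortedMap (unrot n b))
      (sortedMap (rot n b)) := by
  constructor <;>
    simp only [SideBelow, sortedMap, rot, unrot, IsDiag, Cross, Prod.forall, Prod.mk.injEq,
      ne_eq] at hd ⊢ <;>
    intros
  case cross_up => split_ifs <;> omega
  all_goals grind

/-- If a diagonal `d = (a, b)` belongs to two triangulations `T₁`, `T₂` of the convex
`n`-gon, then `T₁` and `T₂` restrict to triangulations of the two sub-polygons cut off
by `d`, and flip sequences between the restrictions concatenate to a flip sequence
between `T₁` and `T₂` of the same total length. -/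
theorem common_diagonal_splits (n a b : ℕ) (T₁ T₂ : Finset (ℕ × ℕ))
    (h₁ : IsTriangulation n T₁) (h₂ : IsTriangulation n T₂)
    (hd : IsDiag n a b) (hd₁ : (a, b) ∈ T₁) (hd₂ : (a, b) ∈ T₂) :
    IsTriangulation (b - a + 1) (restrictAbove a b T₁) ∧
    IsTriangulation (b - a + 1) (restrictAbove a b T₂) ∧
    IsTriangulation (n - (b - a) + 1) (restrictBelow n a b T₁) ∧
    IsTriangulation (n - (b - a) + 1) (restrictBelow n a b T₂) ∧
    ∀ k₁ k₂ : ℕ,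
      FlipSeq (b - a + 1) k₁ (restrictAbove a b T₁) (restrictAbove a b T₂) →
      FlipSeq (n - (b - a) + 1) k₂ (restrictBelow n a b T₁) (restrictBelow n a b T₂) →
      FlipSeq n (k₁ + k₂) T₁ T₂ := by
  have hs := separatedBy_sides hd
  have hA := subpolygonChart_above hd
  have hB := subpolygonChart_below hd
  have hB₁ := hB.isTriangulation_restrictTo hs.symm h₁ hd₁
  have hA₂ := hA.isTriangulation_restrictTo hs h₂ hd₂
  simp only [restrictAbove_eq, restrictBelow_eq]
  refine ⟨hA.isTriangulation_restrictTo hs h₁ hd₁, hA₂, hB₁,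
    hB.isTriangulation_restrictTo hs.symm h₂ hd₂, fun k₁ k₂ hk₁ hk₂ => ?_⟩
  have hf := hA.flipSeq_glue hB hs hk₁ hB₁
  have hf' := hB.flipSeq_glue hA hs.symm hk₂ hA₂
  rw [hA.glue_restrictTo hB hs h₁ hd₁] at hf
  rw [hB.glue_restrictTo hA hs.symm h₂ hd₂, glue_comm] at hf'
  exact hf.trans hf'
end
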